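/- Fix an integer s ≥ 0. Let P = conv{x_1,…,x_m} ⊂ ℝ^d be a full-dimensional compact convex polytope each of whose facets is a simplicial polytope, and for each facet F fix a triangulation Σ_F of F into (d−1)-simplices using only vertices of F, with facet adjoint Ad_F(t) = ∑_{σ∈Σ_F} (V_{d−1}(σ)/V_{d−1}(F)) ∏_{k∈F∖σ} ℒ_k(t). Then there is a neighborhood U of 0 in ℝ^d such that for all t ∈ U, as an identity in the s-fold tensor power of ℝ^d, ∑_{r≥0} ((r+d−1)!/((d−1)!·r!·s!·ω_{1+s})) ∑_{F facet of P} (∫_F ⟨x,t⟩^r H^{d−1}(dx)) · u_F^{⊗s} = (1/(s!·ω_{1+s})) ∑_{F facet of P} (V_{d−1}(F)·Ad_F(t)·u_F^{⊗s}) / ∏_{k∈F} ℒ_k(t) = (1/(s!·ω_{1+s})) · (∑_{F facet of P} V_{d−1}(F)·Ad_F(t)·u_F^{⊗s}·∏_{k∉F} ℒ_k(t)) / ∏_{k=1}^m ℒ_k(t), the series converging absolutely; here the left-hand side is ∑_{r≥0} ((r+d−1)!/(d−1)!)·Φ_{d−1}^{r,s}(P)(t), the generating function of the rank r+s Minkowski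 surface tensors of P. -/

import Mathlib

open MeasureTheory Finset

/-- A triangulation of the facet `conv{x_k : k ∈ F}` of a polytope in Euclidean `ℝ^d`
into `(d−1)`-simplices using only the vertices of the facet: their union is the facet
and their relative interiors are pairwise disjoint. -/
structure FacetTri (d m : ℕ) (x : Fin m → EuclideanSpace ℝ (Fin d)) (F : Finset (Fin m)) where
  simplices : Finset (Finset (Fin m))
  subset : ∀ σ ∈ simplices, σ ⊆ F
  card_eq : ∀ σ ∈ simplices, σ.card = d
  indep : ∀ σ ∈ simplices, AffineIndependent ℝ (fun k : {k // k ∈ σ} => x k.1)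
  covers : (⋃ σ ∈ simplices, convexHull ℝ (x '' ↑σ)) = convexHull ℝ (x '' ↑F)
  disj : ∀ σ ∈ simplices, ∀ τ ∈ simplices, σ ≠ τ →
    intrinsicInterior ℝ (convexHull ℝ (x '' ↑σ)) ∩
      intrinsicInterior ℝ (convexHull ℝ (x '' ↑τ)) = ∅

/-- `(d−1)`-dimensional Hausdorff volume `V_{d−1}(S) = H^{d−1}(S)`. -/
noncomputable def hVol (d : ℕ) (S : Set (EuclideanSpace ℝ (Fin d))) : ℝ :=
  (μH[(d : ℝ) - 1] S).toReal

/-- `ω_j`, the surface area of the unit sphere `S^{j−1} ⊆ ℝ^j`: `ω_j = 2π^{j/2}/Γ(j/2)`. -/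
noncomputable def omegaSphere (j : ℕ) : ℝ :=
  2 * Real.pi ^ ((j : ℝ) / 2) / Real.Gamma ((j : ℝ) / 2)

/-- `ℒ_k(t) = 1 − ⟨x_k, t⟩`. -/
noncomputable def lin (d m : ℕ) (x : Fin m → EuclideanSpace ℝ (Fin d)) (k : Fin m)
    (t : EuclideanSpace ℝ (Fin d)) : ℝ :=
  1 - ∑ j, x k j * t j

/-- The facet adjoint `Ad_F(t) = ∑_{σ∈Σ_F} (V_{d−1}(σ)/V_{d−1}(F)) ∏_{k∈F∖σ} ℒ_k(t)`,
as a function of `t`. -/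
noncomputable def facetAdj (d m : ℕ) (x : Fin m → EuclideanSpace ℝ (Fin d))
    (F : Finset (Fin m)) (T : FacetTri d m x F) (t : EuclideanSpace ℝ (Fin d)) : ℝ :=
  ∑ σ ∈ T.simplices,
    (hVol d (convexHull ℝ (x '' ↑σ)) / hVol d (convexHull ℝ (x '' ↑F))) *
      ∏ k ∈ F \ σ, lin d m x k t

/-- The corner simplex `{z ≥ 0, ∑ zᵢ ≤ 1}` in `ℝⁿ`. -/
def cornerSimplex (n : ℕ) : Set (Fin n → ℝ) := {z | (∀ i, 0 ≤ z i) ∧ ∑ i, z i ≤ 1}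

theorem isCompact_cornerSimplex (n : ℕ) : IsCompact (cornerSimplex n) := by
  refine (isCompact_univ_pi (fun _ : Fin n => isCompact_Icc (a := (0 : ℝ))
    (b := 1))).of_isClosed_subset ?_ ?_
  · have h1 : IsClosed {z : Fin n → ℝ | ∀ i, 0 ≤ z i} := by
      simpa only [Set.ofPred_forall] using isClosed_iInter fun i : Fin n =>
        isClosed_le (f := fun _ : Fin n → ℝ => (0 : ℝ)) continuous_const (continuous_apply i)
    exact h1.inter
      (isClosed_le (f := fun z : Fin n → ℝ => ∑ i, z i) (by fun_prop) continuous_const)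
  · rintro z ⟨h0, h1⟩ i -
    exact ⟨h0 i, (Finset.single_le_sum (fun j _ => h0 j) (Finset.mem_univ i)).trans h1⟩

theorem convex_cornerSimplex (n : ℕ) : Convex ℝ (cornerSimplex n) := by
  rintro z ⟨hz, hz'⟩ w ⟨hw, hw'⟩ a b ha hb hab
  refine ⟨fun i => add_nonneg (mul_nonneg ha (hz i)) (mul_nonneg hb (hw i)), ?_⟩
  simp only [Pi.add_apply, Pi.smul_apply, smul_eq_mul, Finset.sum_add_distrib, ← Finset.mul_sum]
  nlinarith

theorem measurableSet_cornerSimplex (n : ℕ) : MeasurableSet (cornerSimplex n) :=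
  (isCompact_cornerSimplex n).measurableSet

theorem cons_mem_cornerSimplex {n : ℕ} {τ : ℝ} (hτ : 0 < τ) (w : Fin n → ℝ) :
    (Fin.cons (1 - τ) (τ • w) : Fin (n + 1) → ℝ) ∈ cornerSimplex (n + 1) ↔
      τ ≤ 1 ∧ w ∈ cornerSimplex n := by
  simp only [cornerSimplex, Set.mem_ofPred_eq, Fin.forall_fin_succ, Fin.sum_univ_succ,
    Fin.cons_zero, Fin.cons_succ, Pi.smul_apply, smul_eq_mul, ← Finset.mul_sum,
    mul_nonneg_iff_of_pos_left hτ, sub_nonneg]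
  constructor
  · rintro ⟨⟨h1, h2⟩, h3⟩
    exact ⟨h1, h2, by nlinarith⟩
  · rintro ⟨h1, h2, h3⟩
    exact ⟨⟨h1, h2⟩, by nlinarith⟩

theorem cons_mem_cornerSimplex_of_mem_Icc {n : ℕ} {τ : ℝ} (hτ : τ ∈ Set.Icc (0 : ℝ) 1)
    {w : Fin n → ℝ} (hw : w ∈ cornerSimplex n) :
    (Fin.cons (1 - τ) (τ • w) : Fin (n + 1) → ℝ) ∈ cornerSimplex (n + 1) := by
  rcases hτ.1.eq_or_lt with rfl | h
  · simp [cornerSimplex, Fin.forall_fin_succ, Fin.sum_univ_succ]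
  · exact (cons_mem_cornerSimplex h w).2 ⟨hτ.2, hw⟩

theorem nonneg_and_le_one_of_cons_mem {n : ℕ} {a : ℝ} {w : Fin n → ℝ}
    (h : (Fin.cons a w : Fin (n + 1) → ℝ) ∈ cornerSimplex (n + 1)) : 0 ≤ a ∧ a ≤ 1 := by
  obtain ⟨h0, h1⟩ := h
  exact ⟨h0 0, (Finset.single_le_sum (fun j _ => h0 j) (Finset.mem_univ 0)).trans h1⟩

/-- Integration over the corner simplex as a cone over a lower-dimensional one. -/
theorem setIntegral_cornerSimplex_succ {n : ℕ} {g : (Fin (n + 1) → ℝ) → ℝ}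
    (hg : ContinuousOn g (cornerSimplex (n + 1))) :
    ∫ z in cornerSimplex (n + 1), g z =
      ∫ w in cornerSimplex n, ∫ τ in Set.Icc (0 : ℝ) 1, τ ^ n * g (Fin.cons (1 - τ) (τ • w)) := by
  set G := (cornerSimplex (n + 1)).indicator g with hG
  have hGi : Integrable G :=
    (integrable_indicator_iff (measurableSet_cornerSimplex _)).2
      (hg.integrableOn_compact (isCompact_cornerSimplex _))
  have hmp := (volume_preserving_piFinSuccAbove (fun _ : Fin (n + 1) => ℝ) 0).symm
  have hcons : ∀ p : ℝ × (Fin n → ℝ),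
      (MeasurableEquiv.piFinSuccAbove (fun _ : Fin (n + 1) => ℝ) 0).symm p = Fin.cons p.1 p.2 := by
    intro p
    ext i
    refine Fin.cases ?_ (fun j => ?_) i <;> simp [MeasurableEquiv.piFinSuccAbove]
  have h1 : ∫ z, G z = ∫ p : ℝ × (Fin n → ℝ), G (Fin.cons p.1 p.2) := by
    rw [← hmp.integral_comp' G]
    simp only [hcons]
  have h1i : Integrable (fun p : ℝ × (Fin n → ℝ) => G (Fin.cons p.1 p.2))
      (volume.prod volume) := by
    have := (hmp.integrable_comp_emb (MeasurableEquiv.measurableEmbedding _)).2 hGi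
    exact this.congr (Filter.Eventually.of_forall fun p => by
      rw [Function.comp_apply, hcons])
  rw [← integral_indicator (measurableSet_cornerSimplex _), ← hG, h1, Measure.volume_eq_prod,
    integral_prod _ h1i]
  rw [← integral_sub_left_eq_self (fun a => ∫ y, G (Fin.cons a y)) volume 1]
  have h2 : ∫ τ, ∫ y, G (Fin.cons (1 - τ) y) = ∫ τ in Set.Icc (0 : ℝ) 1,
      ∫ w in cornerSimplex n, τ ^ n * g (Fin.cons (1 - τ) (τ • w)) := by
    rw [← integral_indicator measurableSet_Icc]
    refine integral_congr_ae ?_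
    filter_upwards [Measure.ae_ne volume (0 : ℝ)] with τ hτ0
    by_cases hτ : τ ∈ Set.Icc (0 : ℝ) 1
    · have hpos : 0 < τ := lt_of_le_of_ne hτ.1 (Ne.symm hτ0)
      rw [Set.indicator_of_mem hτ]
      have := Measure.integral_comp_smul (volume : Measure (Fin n → ℝ))
        (fun y => G (Fin.cons (1 - τ) y)) τ
      simp only [Module.finrank_fin_fun, smul_eq_mul] at this
      rw [abs_of_pos (by positivity), ← mul_right_inj' (pow_pos hpos n).ne',
        mul_inv_cancel_left₀ (pow_pos hpos n).ne'] at this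
      rw [← this, ← integral_const_mul, ← integral_indicator (measurableSet_cornerSimplex _)]
      congr 1
      ext w
      by_cases hw : w ∈ cornerSimplex n
      · rw [Set.indicator_of_mem hw, hG,
          Set.indicator_of_mem ((cons_mem_cornerSimplex hpos w).2 ⟨hτ.2, hw⟩)]
      · rw [Set.indicator_of_notMem hw, hG, Set.indicator_of_notMem, mul_zero]
        exact fun h => hw ((cons_mem_cornerSimplex hpos w).1 h).2
    · rw [Set.indicator_of_notMem hτ]
      refine integral_eq_zero_of_ae (Filter.Eventually.of_forall fun y => ?_)
      refine Set.indicator_of_notMem (fun h => hτ ?_) _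
      have := nonneg_and_le_one_of_cons_mem h
      constructor <;> linarith
  rw [h2]
  refine integral_integral_swap ?_
  rw [Measure.prod_restrict]
  refine ContinuousOn.integrableOn_compact (isCompact_Icc.prod (isCompact_cornerSimplex n)) ?_
  have hc : Continuous fun p : ℝ × (Fin n → ℝ) =>
      (Fin.cons (1 - p.1) (p.1 • p.2) : Fin (n + 1) → ℝ) := by fun_prop
  refine ContinuousOn.mul (by fun_prop) (hg.comp hc.continuousOn ?_)
  rintro ⟨τ, w⟩ ⟨hτ, hw⟩
  exact cons_mem_cornerSimplex_of_mem_Icc hτ hw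

/-- The point with barycentric coordinates `(z, 1 - ∑ z)` relative to `b`. -/
def baryComb {E : Type*} [AddCommGroup E] [Module ℝ E] {n : ℕ} (b : Fin (n + 1) → E)
    (z : Fin n → ℝ) : E :=
  (∑ i, z i • b i.castSucc) + (1 - ∑ i, z i) • b (Fin.last n)

theorem continuous_baryComb {E : Type*} [AddCommGroup E] [Module ℝ E] [TopologicalSpace E]
    [ContinuousAdd E] [ContinuousSMul ℝ E] {n : ℕ} (b : Fin (n + 1) → E) :
    Continuous (baryComb b) := by
  unfold baryComb
  fun_prop

theorem baryComb_cons {n : ℕ} (b : Fin (n + 2) → ℝ) (τ : ℝ) (w : Fin n → ℝ) :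
    baryComb b (Fin.cons (1 - τ) (τ • w)) =
      (1 - τ) * b 0 + τ * baryComb (fun i => b i.succ) w := by
  simp only [baryComb, Fin.sum_univ_succ, Fin.cons_zero, Fin.cons_succ, Pi.smul_apply,
    smul_eq_mul, Fin.castSucc_zero, Fin.succ_last, ← Finset.mul_sum, mul_assoc, mul_add,
    Fin.castSucc_succ]
  ring

theorem baryComb_pos {n : ℕ} {b : Fin (n + 1) → ℝ} (hb : ∀ i, 0 < b i) {z : Fin n → ℝ}
    (hz : z ∈ cornerSimplex n) : 0 < baryComb b z := by
  obtain ⟨h0, h1⟩ := hz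
  have hs : 0 ≤ ∑ i, z i • b i.castSucc :=
    Finset.sum_nonneg fun i _ => mul_nonneg (h0 i) (hb _).le
  rcases h1.lt_or_eq with h | h
  · exact add_pos_of_nonneg_of_pos hs (mul_pos (by linarith) (hb _))
  · rw [baryComb, h, sub_self, zero_smul, add_zero]
    refine lt_of_le_of_ne hs fun hE => ?_
    have := (Finset.sum_eq_zero_iff_of_nonneg
      fun i _ => mul_nonneg (h0 i) (hb i.castSucc).le).1 hE.symm
    have hz0 : ∀ i, z i = 0 := fun i => by simpa [(hb _).ne'] using this i (Finset.mem_univ i)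
    simp [hz0] at h

theorem integral_segment_feynman (n : ℕ) {b B : ℝ} (hb : 0 < b) (hB : 0 < B) :
    ∫ τ in Set.Icc (0 : ℝ) 1, τ ^ n * (((1 - τ) * b + τ * B) ^ (n + 2))⁻¹ =
      ((n + 1) * b)⁻¹ * (B ^ (n + 1))⁻¹ := by
  have hD : ∀ τ ∈ Set.uIcc (0 : ℝ) 1, 0 < (1 - τ) * b + τ * B := by
    intro τ hτ
    rw [Set.uIcc_of_le zero_le_one] at hτ
    nlinarith [hτ.1, hτ.2, mul_nonneg hτ.1 hB.le, mul_nonneg (sub_nonneg.2 hτ.2) hb.le,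
      lt_min hb hB, mul_le_mul_of_nonneg_left (min_le_left b B) (sub_nonneg.2 hτ.2),
      mul_le_mul_of_nonneg_left (min_le_right b B) hτ.1]
  rw [integral_Icc_eq_integral_Ioc, ← intervalIntegral.integral_of_le zero_le_one]
  rw [intervalIntegral.integral_eq_sub_of_hasDerivAt
    (f := fun τ => ((n + 1) * b)⁻¹ * (τ / ((1 - τ) * b + τ * B)) ^ (n + 1))]
  · simp
  · intro τ hτ
    have h := hD τ hτ
    have h1 : HasDerivAt (fun τ : ℝ => (1 - τ) * b + τ * B) (-1 * b + 1 * B) τ :=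
      (((hasDerivAt_id τ).const_sub 1).mul_const b).add ((hasDerivAt_id τ).mul_const B)
    have h2 : HasDerivAt (fun τ : ℝ => τ / ((1 - τ) * b + τ * B))
        ((1 * ((1 - τ) * b + τ * B) - τ * (-1 * b + 1 * B)) / ((1 - τ) * b + τ * B) ^ 2) τ :=
      (hasDerivAt_id τ).div h1 h.ne'
    convert! (h2.pow (n + 1)).const_mul (((n : ℝ) + 1) * b)⁻¹ using 1
    simp only [Nat.add_sub_cancel, div_pow]
    push_cast
    field_simp
    ring
  · refine ContinuousOn.intervalIntegrable ?_
    refine ContinuousOn.mul (by fun_prop) (ContinuousOn.inv₀ (by fun_prop) ?_)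
    exact fun τ hτ => (pow_pos (hD τ hτ) _).ne'

/-- Feynman's parametrization. -/
theorem integral_cornerSimplex_feynman (n : ℕ) {b : Fin (n + 1) → ℝ} (hb : ∀ i, 0 < b i) :
    ∫ z in cornerSimplex n, (baryComb b z ^ (n + 1))⁻¹ = (n.factorial * ∏ i, b i)⁻¹ := by
  induction n with
  | zero =>
    have : cornerSimplex 0 = Set.univ := by ext; simp [cornerSimplex]
    simp [this, baryComb, Measure.real, volume_pi]
  | succ n ih =>
    rw [setIntegral_cornerSimplex_succ]
    · have : ∀ w ∈ cornerSimplex n, ∫ τ in Set.Icc (0 : ℝ) 1,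
          τ ^ n * (baryComb b (Fin.cons (1 - τ) (τ • w)) ^ (n + 1 + 1))⁻¹ =
            ((n + 1) * b 0)⁻¹ * (baryComb (fun i => b i.succ) w ^ (n + 1))⁻¹ := by
        intro w hw
        simp only [baryComb_cons]
        exact integral_segment_feynman n (hb 0) (baryComb_pos (fun i => hb i.succ) hw)
      rw [setIntegral_congr_fun (measurableSet_cornerSimplex n) this, integral_const_mul,
        ih fun i => hb i.succ, Fin.prod_univ_succ b, Nat.factorial_succ, ← mul_inv]
      push_cast
      congr 1
      ring
    · refine ContinuousOn.inv₀ ((continuous_baryComb b).pow _).continuousOn ?_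
      exact fun z hz => (pow_pos (baryComb_pos hb hz) _).ne'

theorem baryComb_mem_convexHull {E : Type*} [AddCommGroup E] [Module ℝ E] {n : ℕ}
    (y : Fin (n + 1) → E) {z : Fin n → ℝ} (hz : z ∈ cornerSimplex n) :
    baryComb y z ∈ convexHull ℝ (Set.range y) := by
  have := (convex_convexHull ℝ (Set.range y)).sum_mem (t := Finset.univ)
    (w := (Fin.snoc z (1 - ∑ i, z i) : Fin (n + 1) → ℝ)) (z := y) ?_ ?_
    fun i _ => subset_convexHull ℝ _ (Set.mem_range_self i)
  · simpa [Fin.sum_univ_castSucc, baryComb] using this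
  · intro i _
    refine Fin.lastCases ?_ (fun j => ?_) i
    · simpa using hz.2
    · simpa using hz.1 j
  · simp [Fin.sum_univ_castSucc]

theorem convexHull_range_eq_image_baryComb {E : Type*} [AddCommGroup E] [Module ℝ E] {n : ℕ}
    (y : Fin (n + 1) → E) :
    convexHull ℝ (Set.range y) = baryComb y '' cornerSimplex n := by
  refine (convexHull_min ?_ ?_).antisymm ?_
  · rintro _ ⟨i, rfl⟩
    refine Fin.lastCases ?_ (fun j => ?_) i
    · exact ⟨0, by simp [cornerSimplex], by simp [baryComb]⟩
    · refine ⟨Pi.single j 1, ⟨fun i => ?_, by simp⟩, ?_⟩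
      · by_cases h : i = j <;> simp [h]
      · simp [baryComb, Pi.single_apply, ite_smul]
  · rintro _ ⟨z, hz, rfl⟩ _ ⟨w, hw, rfl⟩ a b ha hb hab
    refine ⟨a • z + b • w, convex_cornerSimplex n hz hw ha hb hab, ?_⟩
    simp only [baryComb, Pi.add_apply, Pi.smul_apply, add_smul, Finset.sum_add_distrib,
      smul_add, Finset.smul_sum, smul_smul, smul_eq_mul, ← Finset.mul_sum]
    rw [add_add_add_comm, ← add_smul]
    congr 2
    linear_combination -hab
  · rintro _ ⟨z, hz, rfl⟩
    exact baryComb_mem_convexHull y hz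

theorem map_baryComb {E F : Type*} [AddCommGroup E] [Module ℝ E] [AddCommGroup F] [Module ℝ F]
    {n : ℕ} (L : E →ₗ[ℝ] F) (y : Fin (n + 1) → E) (z : Fin n → ℝ) :
    L (baryComb y z) = baryComb (fun i => L (y i)) z := by
  simp [baryComb]

section Simplex

variable {E : Type*} [NormedAddCommGroup E] [NormedSpace ℝ E]

/-- The affine parametrization of an `n`-simplex, factored through a linear isomorphism onto
the direction of its affine span. -/
theorem exists_baryComb_eq_add {n : ℕ} {y : Fin (n + 1) → E} (hy : AffineIndependent ℝ y) :
    ∃ (V : Submodule ℝ E) (e : (Fin n → ℝ) ≃L[ℝ] V),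
      ∀ z, baryComb y z = y (Fin.last n) + (e z : E) := by
  have hlin : LinearIndependent ℝ fun i : Fin n => y i.castSucc - y (Fin.last n) := by
    have h := (affineIndependent_iff_linearIndependent_vsub ℝ y (Fin.last n)).1 hy
    exact h.comp (fun i : Fin n => ⟨i.castSucc, (Fin.castSucc_lt_last i).ne⟩)
      fun i j hij => Fin.castSucc_injective n (Subtype.ext_iff.1 hij)
  let L : (Fin n → ℝ) →ₗ[ℝ] E := Fintype.linearCombination ℝ fun i => y i.castSucc - y (Fin.last n)
  have hL : Function.Injective L := hlin.fintypeLinearCombination_injective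
  refine ⟨L.range, (LinearEquiv.ofInjective L hL).toContinuousLinearEquiv, fun z => ?_⟩
  simp only [baryComb, LinearEquiv.coe_toContinuousLinearEquiv', LinearEquiv.ofInjective_apply, L,
    Fintype.linearCombination_apply, smul_sub, Finset.sum_sub_distrib, sub_smul, one_smul,
    Finset.sum_smul]
  abel

variable [MeasurableSpace E] [BorelSpace E]

/-- On an `n`-simplex, the `n`-dimensional Hausdorff measure is a multiple of the image of
Lebesgue measure on the corner simplex. -/
theorem exists_hausdorffMeasure_restrict_simplex {n : ℕ} {y : Fin (n + 1) → E}
    (hy : AffineIndependent ℝ y) :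
    ∃ κ : NNReal, (μH[(n : ℝ)] : Measure E).restrict (convexHull ℝ (Set.range y)) =
      κ • (volume.restrict (cornerSimplex n)).map (baryComb y) := by
  obtain ⟨V, e, he⟩ := exists_baryComb_eq_add hy
  have hV : Module.finrank ℝ V = n := by
    rw [← e.toLinearEquiv.finrank_eq, Module.finrank_fin_fun]
  have : FiniteDimensional ℝ V := e.toLinearEquiv.finiteDimensional
  let A : V → E := fun v => y (Fin.last n) + v
  have hA : Isometry A := (isometry_add_left (y (Fin.last n))).comp isometry_subtype_coe
  have hφ : baryComb y = A ∘ e := funext he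
  have hAm : MeasurableEmbedding A := hA.isClosedEmbedding.measurableEmbedding
  have hm : MeasurableEmbedding (baryComb y) := by
    rw [hφ]
    exact hAm.comp e.toHomeomorph.measurableEmbedding
  have hH : (μH[(n : ℝ)] : Measure V).IsAddHaarMeasure := by
    have := isAddHaarMeasure_hausdorffMeasure (E := V)
    rwa [hV] at this
  refine ⟨Measure.addHaarScalarFactor (μH[(n : ℝ)] : Measure V) (volume.map e), ?_⟩
  set κ := Measure.addHaarScalarFactor (μH[(n : ℝ)] : Measure V) (volume.map e)
  have h1 : (μH[(n : ℝ)] : Measure V) = κ • volume.map e :=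
    Measure.isAddLeftInvariant_eq_smul _ _
  have h2 : (μH[(n : ℝ)] : Measure E).restrict (Set.range A) = κ • volume.map (baryComb y) := by
    rw [← hA.map_hausdorffMeasure (Or.inl n.cast_nonneg), h1, Measure.map_smul,
      Measure.map_map hAm.measurable e.continuous.measurable, hφ]
  have himg := convexHull_range_eq_image_baryComb y
  have hsub : convexHull ℝ (Set.range y) ⊆ Set.range A := by
    rw [himg, hφ, Set.image_comp]
    exact Set.image_subset_range _ _
  rw [← Set.inter_eq_left.2 hsub, ← Measure.restrict_restrict', h2, Measure.restrict_smul,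
    hm.restrict_map, himg, hm.injective.preimage_image]
  exact hAm.measurableSet_range

/-- The relative boundary of a simplex is a null set. -/
theorem hausdorffMeasure_simplex_diff_intrinsicInterior {n : ℕ} {y : Fin (n + 1) → E}
    (hy : AffineIndependent ℝ y) :
    (μH[(n : ℝ)] : Measure E) (convexHull ℝ (Set.range y) \
      intrinsicInterior ℝ (convexHull ℝ (Set.range y))) = 0 := by
  obtain ⟨V, e, he⟩ := exists_baryComb_eq_add hy
  have hV : Module.finrank ℝ V = n := by
    rw [← e.toLinearEquiv.finrank_eq, Module.finrank_fin_fun]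
  have : FiniteDimensional ℝ V := e.toLinearEquiv.finiteDimensional
  let A : V →ᵃⁱ[ℝ] E := (AffineIsometryEquiv.constVAdd ℝ E (y (Fin.last n))).toAffineIsometry.comp
    V.subtypeₗᵢ.toAffineIsometry
  have hφ : baryComb y = A ∘ e := funext fun z => by simp [he, A]
  have hH : (μH[(n : ℝ)] : Measure V).IsAddHaarMeasure := by
    have := isAddHaarMeasure_hausdorffMeasure (E := V)
    rwa [hV] at this
  have hconv : Convex ℝ (e '' cornerSimplex n) := (convex_cornerSimplex n).linear_image e.toLinearMap
  rw [convexHull_range_eq_image_baryComb, hφ, Set.image_comp, A.intrinsicInterior_image]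
  refine measure_mono_null (t := A '' frontier (e '' cornerSimplex n)) ?_ ?_
  · rw [← Set.image_sdiff A.injective]
    refine Set.image_mono fun v hv => ⟨subset_closure hv.1, fun h => hv.2 ?_⟩
    exact interior_subset_intrinsicInterior h
  · rw [A.isometry.hausdorffMeasure_image (Or.inl n.cast_nonneg)]
    exact hconv.addHaar_frontier _

end Simplex

theorem volume_cornerSimplex (n : ℕ) :
    (volume : Measure (Fin n → ℝ)).real (cornerSimplex n) = (n.factorial : ℝ)⁻¹ := by
  have h := integral_cornerSimplex_feynman n (b := fun _ => 1) fun _ => one_pos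
  simpa [baryComb] using h

theorem abs_baryComb_le {n : ℕ} {a : Fin (n + 1) → ℝ} {ρ : ℝ} (ha : ∀ i, |a i| ≤ ρ)
    {z : Fin n → ℝ} (hz : z ∈ cornerSimplex n) : |baryComb a z| ≤ ρ := by
  refine abs_le.2 (convexHull_min (t := Set.Icc (-ρ) ρ) ?_ (convex_Icc _ _)
    (baryComb_mem_convexHull a hz))
  rintro _ ⟨i, rfl⟩
  exact abs_le.1 (ha i)

theorem one_sub_baryComb {n : ℕ} (a : Fin (n + 1) → ℝ) (z : Fin n → ℝ) :
    1 - baryComb a z = baryComb (fun i => 1 - a i) z := by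
  simp only [baryComb, smul_eq_mul, mul_sub, mul_one, Finset.sum_sub_distrib]
  ring

theorem hasSum_integral_cornerSimplex {n : ℕ} {a : Fin (n + 1) → ℝ} {ρ : ℝ} (hρ : ρ < 1)
    (ha : ∀ i, |a i| ≤ ρ) :
    HasSum (fun r : ℕ => ((r + n).choose n : ℝ) * ∫ z in cornerSimplex n, baryComb a z ^ r)
      (volume.real (cornerSimplex n) * (∏ i, (1 - a i))⁻¹) := by
  have hρ0 : 0 ≤ ρ := (abs_nonneg _).trans (ha 0)
  have hfin : IsFiniteMeasure (volume.restrict (cornerSimplex n)) :=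
    isFiniteMeasure_restrict.2 (isCompact_cornerSimplex n).measure_lt_top.ne
  have hmem : ∀ᵐ z ∂(volume.restrict (cornerSimplex n)), z ∈ cornerSimplex n :=
    ae_restrict_mem (measurableSet_cornerSimplex n)
  have key := hasSum_integral_of_dominated_convergence (μ := volume.restrict (cornerSimplex n))
    (F := fun r z => ((r + n).choose n : ℝ) * baryComb a z ^ r)
    (f := fun z => (baryComb (fun i => 1 - a i) z ^ (n + 1))⁻¹)
    (fun r _ => ((r + n).choose n : ℝ) * ρ ^ r)
    (fun r => (((continuous_baryComb a).pow r).const_mul _).aestronglyMeasurable)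
    (fun r => by
      filter_upwards [hmem] with z hz
      rw [norm_mul, norm_pow, Real.norm_eq_abs, Real.norm_eq_abs, Nat.abs_cast]
      gcongr
      exact abs_baryComb_le ha hz)
    (Filter.Eventually.of_forall fun _ =>
      summable_choose_mul_geometric_of_norm_lt_one n (by rwa [Real.norm_of_nonneg hρ0]))
    (integrable_const _)
    (by
      filter_upwards [hmem] with z hz
      rw [← one_sub_baryComb, ← one_div]
      exact hasSum_choose_mul_geometric_of_norm_lt_one n
        ((abs_baryComb_le ha hz).trans_lt hρ))
  simp only [integral_const_mul] at key
  rwa [integral_cornerSimplex_feynman n fun i => by linarith [abs_le.1 (ha i)], mul_inv,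
    ← volume_cornerSimplex] at key

section SimplexIntegral

variable {E : Type*} [NormedAddCommGroup E] [NormedSpace ℝ E] [MeasurableSpace E] [BorelSpace E]

theorem hausdorffMeasure_simplex_lt_top {n : ℕ} {y : Fin (n + 1) → E}
    (hy : AffineIndependent ℝ y) :
    (μH[(n : ℝ)] : Measure E) (convexHull ℝ (Set.range y)) < ⊤ := by
  obtain ⟨κ, hκ⟩ := exists_hausdorffMeasure_restrict_simplex hy
  rw [← Measure.restrict_apply_univ, hκ, Measure.smul_apply,
    Measure.map_apply (continuous_baryComb y).measurable MeasurableSet.univ]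
  simp only [Set.preimage_univ, Measure.restrict_apply_univ]
  exact ENNReal.mul_lt_top ENNReal.coe_lt_top (isCompact_cornerSimplex n).measure_lt_top

theorem hasSum_integral_simplex {n : ℕ} {y : Fin (n + 1) → E} (hy : AffineIndependent ℝ y)
    (L : E →L[ℝ] ℝ) {ρ : ℝ} (hρ : ρ < 1) (hL : ∀ i, |L (y i)| ≤ ρ) :
    HasSum (fun r : ℕ => ((r + n).choose n : ℝ) *
        ∫ p in convexHull ℝ (Set.range y), L p ^ r ∂μH[(n : ℝ)])
      ((μH[(n : ℝ)] : Measure E).real (convexHull ℝ (Set.range y)) * (∏ i, (1 - L (y i)))⁻¹) := by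
  obtain ⟨κ, hκ⟩ := exists_hausdorffMeasure_restrict_simplex hy
  have hint : ∀ g : E → ℝ, Continuous g →
      ∫ p in convexHull ℝ (Set.range y), g p ∂μH[(n : ℝ)] =
        κ * ∫ z in cornerSimplex n, g (baryComb y z) := by
    intro g hg
    rw [hκ, integral_smul_nnreal_measure, integral_map
      (continuous_baryComb y).measurable.aemeasurable hg.aestronglyMeasurable]
    rfl
  have hvol := hint (fun _ => 1) continuous_const
  simp only [setIntegral_const, smul_eq_mul, mul_one] at hvol
  rw [hvol, mul_assoc]
  convert! (hasSum_integral_cornerSimplex hρ hL).mul_left (κ : ℝ) using 1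
  funext r
  rw [hint (fun p => L p ^ r) (L.continuous.pow r)]
  have hB : ∀ z, baryComb (fun i => L (y i)) z = L (baryComb y z) :=
    fun z => (map_baryComb (L : E →ₗ[ℝ] ℝ) y z).symm
  simp only [hB]
  ring

end SimplexIntegral

section Facet

variable {n m : ℕ} {x : Fin m → EuclideanSpace ℝ (Fin (n + 1))}

theorem exists_range_eq_image {σ : Finset (Fin m)} (hσ : σ.card = n + 1)
    (hind : AffineIndependent ℝ fun k : {k // k ∈ σ} => x k.1) :
    ∃ e : Fin (n + 1) ≃ {k // k ∈ σ}, AffineIndependent ℝ (fun i => x (e i)) ∧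
      Set.range (fun i => x (e i)) = x '' ↑σ := by
  let e := (σ.orderIsoOfFin hσ).toEquiv
  refine ⟨e, hind.comp_embedding e.toEmbedding, ?_⟩
  rw [show (fun i => x (e i)) = (fun k : {k // k ∈ σ} => x k.1) ∘ e from rfl,
    e.surjective.range_comp, Set.image_eq_range]
  rfl

theorem hVol_succ (S : Set (EuclideanSpace ℝ (Fin (n + 1)))) :
    hVol (n + 1) S = (μH[(n : ℝ)] : Measure _).real S := by
  rw [hVol, Nat.cast_add_one, add_sub_cancel_right, Measure.real]

theorem isCompact_convexHull_image (σ : Finset (Fin m)) : IsCompact (convexHull ℝ (x '' ↑σ)) :=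
  (σ.finite_toSet.image x).isCompact_convexHull (𝕜 := ℝ)

variable {F : Finset (Fin m)}

theorem FacetTri.simplex_measure_lt_top (T : FacetTri (n + 1) m x F)
    {σ : Finset (Fin m)} (hσ : σ ∈ T.simplices) :
    (μH[(n : ℝ)] : Measure (EuclideanSpace ℝ (Fin (n + 1)))) (convexHull ℝ (x '' ↑σ)) < ⊤ := by
  obtain ⟨e, he, hr⟩ := exists_range_eq_image (T.card_eq σ hσ) (T.indep σ hσ)
  exact hr ▸ hausdorffMeasure_simplex_lt_top he

theorem FacetTri.simplex_diff_intrinsicInterior (T : FacetTri (n + 1) m x F)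
    {σ : Finset (Fin m)} (hσ : σ ∈ T.simplices) :
    (μH[(n : ℝ)] : Measure (EuclideanSpace ℝ (Fin (n + 1)))) (convexHull ℝ (x '' ↑σ) \
      intrinsicInterior ℝ (convexHull ℝ (x '' ↑σ))) = 0 := by
  obtain ⟨e, he, hr⟩ := exists_range_eq_image (T.card_eq σ hσ) (T.indep σ hσ)
  exact hr ▸ hausdorffMeasure_simplex_diff_intrinsicInterior he

theorem FacetTri.aedisjoint (T : FacetTri (n + 1) m x F)
    {σ τ : Finset (Fin m)} (hσ : σ ∈ T.simplices) (hτ : τ ∈ T.simplices)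
    (hne : σ ≠ τ) : AEDisjoint (μH[(n : ℝ)] : Measure (EuclideanSpace ℝ (Fin (n + 1))))
      (convexHull ℝ (x '' ↑σ)) (convexHull ℝ (x '' ↑τ)) := by
  refine measure_mono_null ?_ (measure_union_null (T.simplex_diff_intrinsicInterior hσ)
    (T.simplex_diff_intrinsicInterior hτ))
  rintro p ⟨h1, h2⟩
  by_cases h3 : p ∈ intrinsicInterior ℝ (convexHull ℝ (x '' ↑σ))
  · refine Or.inr ⟨h2, fun h4 => ?_⟩
    exact Set.eq_empty_iff_forall_notMem.1 (T.disj σ hσ τ hτ hne) p ⟨h3, h4⟩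
  · exact Or.inl ⟨h1, h3⟩

theorem FacetTri.measure_ne_top (T : FacetTri (n + 1) m x F) :
    (μH[(n : ℝ)] : Measure (EuclideanSpace ℝ (Fin (n + 1)))) (convexHull ℝ (x '' ↑F)) ≠ ⊤ := by
  rw [← T.covers]
  exact ((measure_biUnion_finset_le _ _).trans_lt
    (ENNReal.sum_lt_top.2 fun σ hσ => T.simplex_measure_lt_top hσ)).ne

theorem FacetTri.setIntegral_eq_sum (T : FacetTri (n + 1) m x F)
    {g : EuclideanSpace ℝ (Fin (n + 1)) → ℝ} (hg : Continuous g) :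
    ∫ p in convexHull ℝ (x '' ↑F), g p ∂μH[(n : ℝ)] =
      ∑ σ ∈ T.simplices, ∫ p in convexHull ℝ (x '' ↑σ), g p ∂μH[(n : ℝ)] := by
  have hint : IntegrableOn g (convexHull ℝ (x '' ↑F)) μH[(n : ℝ)] :=
    hg.continuousOn.integrableOn_of_subset_isCompact (isCompact_convexHull_image F)
      (isCompact_convexHull_image F).measurableSet subset_rfl T.measure_ne_top
  have hcov : convexHull ℝ (x '' ↑F) = ⋃ σ : T.simplices, convexHull ℝ (x '' ↑σ.1) := by
    rw [← T.covers, Set.iUnion_subtype]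
  have hae : Pairwise (Function.onFun (AEDisjoint μH[(n : ℝ)])
      fun σ : T.simplices => convexHull ℝ (x '' ↑σ.1)) :=
    fun σ τ h => T.aedisjoint σ.2 τ.2 (Subtype.coe_injective.ne h)
  have hm : ∀ σ : T.simplices, NullMeasurableSet (convexHull ℝ (x '' ↑σ.1)) μH[(n : ℝ)] :=
    fun σ => (isCompact_convexHull_image σ.1).measurableSet.nullMeasurableSet
  rw [hcov] at hint
  rw [hcov, integral_iUnion_ae hm hae hint, tsum_fintype,
    Finset.sum_coe_sort T.simplices
      fun σ => ∫ p in convexHull ℝ (x '' ↑σ), g p ∂μH[(n : ℝ)]]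

theorem FacetTri.hVol_mul_facetAdj (T : FacetTri (n + 1) m x F)
    (t : EuclideanSpace ℝ (Fin (n + 1))) :
    hVol (n + 1) (convexHull ℝ (x '' ↑F)) * facetAdj (n + 1) m x F T t =
      ∑ σ ∈ T.simplices, hVol (n + 1) (convexHull ℝ (x '' ↑σ)) *
        ∏ k ∈ F \ σ, lin (n + 1) m x k t := by
  rw [facetAdj, Finset.mul_sum]
  refine Finset.sum_congr rfl fun σ hσ => ?_
  rw [← mul_assoc, mul_div_cancel_of_imp']
  intro h
  refine le_antisymm (h ▸ ?_) ENNReal.toReal_nonneg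
  rw [hVol_succ, hVol_succ]
  exact measureReal_mono (convexHull_mono (Set.image_mono (T.subset σ hσ))) T.measure_ne_top

theorem FacetTri.hasSum_integral (T : FacetTri (n + 1) m x F)
    {t : EuclideanSpace ℝ (Fin (n + 1))} {ρ : ℝ} (hρ : ρ < 1)
    (ht : ∀ k, |∑ j, x k j * t j| ≤ ρ) :
    HasSum (fun r : ℕ => ((r + n).choose n : ℝ) *
        ∫ p in convexHull ℝ (x '' ↑F), (∑ j, p j * t j) ^ r ∂μH[(n : ℝ)])
      (hVol (n + 1) (convexHull ℝ (x '' ↑F)) * facetAdj (n + 1) m x F T t /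
        ∏ k ∈ F, lin (n + 1) m x k t) := by
  have hne : ∀ k, lin (n + 1) m x k t ≠ 0 := fun k => by
    rw [lin]
    linarith [le_abs_self (∑ j, x k j * t j), ht k]
  let L : EuclideanSpace ℝ (Fin (n + 1)) →L[ℝ] ℝ := ∑ j, t j • EuclideanSpace.proj j
  have hL : ∀ p, L p = ∑ j, p j * t j := fun p => by simp [L, mul_comm]
  rw [T.hVol_mul_facetAdj, Finset.sum_div]
  have hterm : ∀ r : ℕ, ∫ p in convexHull ℝ (x '' ↑F), (∑ j, p j * t j) ^ r ∂μH[(n : ℝ)] =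
      ∑ σ ∈ T.simplices, ∫ p in convexHull ℝ (x '' ↑σ), L p ^ r ∂μH[(n : ℝ)] := fun r => by
    simp only [← hL]
    exact T.setIntegral_eq_sum (g := fun p => L p ^ r) (by fun_prop)
  simp only [hterm, Finset.mul_sum]
  refine hasSum_sum fun σ hσ => ?_
  obtain ⟨e, he, hr⟩ := exists_range_eq_image (T.card_eq σ hσ) (T.indep σ hσ)
  have h := hasSum_integral_simplex he L hρ fun i => by rw [hL]; exact ht _
  rw [hr] at h
  convert! h using 1
  have hprod : ∏ i, (1 - L (x (e i))) = ∏ k ∈ σ, lin (n + 1) m x k t := by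
    rw [e.prod_comp fun k => 1 - L (x k)]
    simp only [hL]
    exact Finset.prod_coe_sort σ fun k => lin (n + 1) m x k t
  rw [hprod, hVol_succ, ← Finset.prod_sdiff (T.subset σ hσ),
    mul_comm (∏ k ∈ F \ σ, _), mul_div_mul_right _ _
      (Finset.prod_ne_zero_iff.2 fun k _ => hne k), div_eq_mul_inv]

end Facet

/-- Fix `s ≥ 0`. Let `P = conv{x_1,…,x_m} ⊆ ℝ^d` be a full-dimensional
compact convex polytope whose facets (described by vertex index sets `F i`, outer unit
normals `u i`, supporting levels `c i`, covering the boundary) are simplicial polytopes,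
each triangulated by `T i`. Then there is a neighborhood `U` of `0` such that for all
`t ∈ U`, componentwise in the `s`-fold tensor power (component `w : Fin s → Fin d`), the
series `∑_{r≥0} ((r+d−1)!/((d−1)!·r!·s!·ω_{1+s})) ∑_F (∫_F ⟨x,t⟩^r dH^{d−1}) u_F^{⊗s}`
converges absolutely and equals
`(1/(s!·ω_{1+s})) ∑_F V_{d−1}(F)·Ad_F(t)·u_F^{⊗s} / ∏_{k∈F} ℒ_k(t)`, which in turn equals
`(1/(s!·ω_{1+s})) (∑_F V_{d−1}(F)·Ad_F(t)·u_F^{⊗s}·∏_{k∉F} ℒ_k(t)) / ∏_{k=1}^m ℒ_k(t)`. -/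
theorem stmt_8 (d m f s : ℕ) (x : Fin m → EuclideanSpace ℝ (Fin d))
    (hfull : (interior (convexHull ℝ (Set.range x))).Nonempty)
    (F : Fin f → Finset (Fin m)) (u : Fin f → EuclideanSpace ℝ (Fin d)) (c : Fin f → ℝ)
    (hnorm : ∀ i, ‖u i‖ = 1)
    (hmem : ∀ i, ∀ k ∈ F i, ∑ j, x k j * u i j = c i)
    (hlt : ∀ i, ∀ k ∉ F i, ∑ j, x k j * u i j < c i)
    (hbound : ∀ p ∈ frontier (convexHull ℝ (Set.range x)),
      ∃ i, p ∈ convexHull ℝ (x '' ↑(F i)))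
    (hinjF : Function.Injective F)
    (T : ∀ i, FacetTri d m x (F i)) :
    ∃ U ∈ nhds (0 : EuclideanSpace ℝ (Fin d)), ∀ t ∈ U, ∀ w : Fin s → Fin d,
      (Summable fun r : ℕ =>
        |(Nat.factorial (r + d - 1) : ℝ) /
            (Nat.factorial (d - 1) * Nat.factorial r * Nat.factorial s *
              omegaSphere (1 + s)) *
          ∑ i, (∫ p in convexHull ℝ (x '' ↑(F i)),
              (∑ j, p j * t j) ^ r ∂(μH[(d : ℝ) - 1])) * ∏ q, u i (w q)|) ∧
      (∑' r : ℕ,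
          (Nat.factorial (r + d - 1) : ℝ) /
              (Nat.factorial (d - 1) * Nat.factorial r * Nat.factorial s *
                omegaSphere (1 + s)) *
            ∑ i, (∫ p in convexHull ℝ (x '' ↑(F i)),
                (∑ j, p j * t j) ^ r ∂(μH[(d : ℝ) - 1])) * ∏ q, u i (w q))
        = (1 / (Nat.factorial s * omegaSphere (1 + s))) *
            ∑ i, hVol d (convexHull ℝ (x '' ↑(F i))) * facetAdj d m x (F i) (T i) t *
              (∏ q, u i (w q)) / ∏ k ∈ F i, lin d m x k t ∧
      (1 / (Nat.factorial s * omegaSphere (1 + s))) *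
          ∑ i, hVol d (convexHull ℝ (x '' ↑(F i))) * facetAdj d m x (F i) (T i) t *
            (∏ q, u i (w q)) / ∏ k ∈ F i, lin d m x k t
        = (1 / (Nat.factorial s * omegaSphere (1 + s))) *
            ((∑ i, hVol d (convexHull ℝ (x '' ↑(F i))) * facetAdj d m x (F i) (T i) t *
              (∏ q, u i (w q)) * ∏ k ∈ (F i)ᶜ, lin d m x k t) / ∏ k, lin d m x k t) := by
  cases d with
  | zero =>
    have hf : IsEmpty (Fin f) := ⟨fun i => by simpa [Subsingleton.elim (u i) 0] using hnorm i⟩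
    refine ⟨Set.univ, Filter.univ_mem, fun t _ w => ?_⟩
    simp
  | succ n =>
    have hcont : ∀ k, Continuous fun t : EuclideanSpace ℝ (Fin (n + 1)) => |∑ j, x k j * t j| :=
      fun k => by fun_prop
    refine ⟨⋂ k, {t | |∑ j, x k j * t j| < 1 / 2}, ?_, fun t ht w => ?_⟩
    · refine Filter.iInter_mem.2 fun k => (isOpen_lt (hcont k) continuous_const).mem_nhds ?_
      simp
    have ht' : ∀ k, |∑ j, x k j * t j| ≤ 1 / 2 := fun k => (Set.mem_iInter.1 ht k).le
    have hne : ∀ k, lin (n + 1) m x k t ≠ 0 := fun k => by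
      rw [lin]
      linarith [le_abs_self (∑ j, x k j * t j), ht' k]
    have hsum := (hasSum_sum fun i (_ : i ∈ Finset.univ) =>
      ((T i).hasSum_integral (by norm_num) ht').mul_right (∏ q, u i (w q))).mul_left
        (1 / (Nat.factorial s * omegaSphere (1 + s)))
    simp only [Nat.cast_add_one, add_sub_cancel_right]
    simp only [div_mul_eq_mul_div _ (∏ k ∈ F _, lin (n + 1) m x k t)] at hsum
    have hseries := hsum.congr_fun (g := fun r : ℕ =>
      (Nat.factorial (r + (n + 1) - 1) : ℝ) /
        (Nat.factorial (n + 1 - 1) * Nat.factorial r * Nat.factorial s * omegaSphere (1 + s)) *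
          ∑ i, (∫ p in convexHull ℝ (x '' ↑(F i)), (∑ j, p j * t j) ^ r ∂(μH[(n : ℝ)])) *
            ∏ q, u i (w q)) fun r => ?_
    · refine ⟨hseries.summable.abs, hseries.tsum_eq, ?_⟩
      congr 1
      rw [Finset.sum_div]
      refine Finset.sum_congr rfl fun i _ => ?_
      rw [← Finset.prod_mul_prod_compl (F i), mul_div_mul_right _ _
        (Finset.prod_ne_zero_iff.2 fun k _ => hne k)]
    · have hcoef : ((r + n).choose n : ℝ) =
          (r + n).factorial / (n.factorial * r.factorial) := by
        rw [Nat.cast_choose ℝ (Nat.le_add_left n r), Nat.add_sub_cancel]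
      simp only [hcoef, mul_assoc, ← Finset.mul_sum]
      rw [← mul_assoc (1 / _), div_mul_div_comm, one_mul, Nat.add_sub_cancel, ← add_assoc,
        Nat.add_sub_cancel]
      congr 2
      ring
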